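/- Let α ∈ (0,1) be irrational with regular continued fraction expansion α = 1/(a_1 + 1/(a_2 + 1/(a_3 + ⋯))) with positive integer partial quotients a_j, and let α_{k,1} be given by the Minkowski chain for α (the case n = 1). Then the partial quotients a_j are bounded if and only if |α_{k,1}| is bounded away from zero. -/

import Mathlib

/-- ξ(r) = p + α₁q₁ + ⋯ + αₙqₙ for r = (q₁, …, qₙ, p) ∈ ℤ^(n+1). -/
noncomputable def xi {n : ℕ} (α : Fin n → ℝ) (r : Fin (n + 1) → ℤ) : ℝ :=
  (r (Fin.last n) : ℝ) + ∑ i : Fin n, α i * (r (Fin.castSucc i) : ℝ)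

/-- The real span of the rows of `A` preceding row `j`. -/
def earlierRowSpan {n : ℕ} (A : Matrix (Fin (n + 1)) (Fin (n + 1)) ℤ) (j : Fin (n + 1)) :
    Submodule ℝ (Fin (n + 1) → ℝ) :=
  Submodule.span ℝ {x : Fin (n + 1) → ℝ | ∃ i : Fin (n + 1), i < j ∧ x = fun k => (A i k : ℝ)}

/-- `A` is the matrix produced by the Minkowski algorithm at stage `m`: each row has sup norm
at most `m`, is linearly independent of the previous rows, minimizes `|ξ|` among all integer
vectors with sup norm at most `m` that are linearly independent of the previous rows, and its
first nonzero entry is positive. -/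
def IsMinkowskiMatrix {n : ℕ} (α : Fin n → ℝ) (m : ℕ)
    (A : Matrix (Fin (n + 1)) (Fin (n + 1)) ℤ) : Prop :=
  ∀ j : Fin (n + 1),
    (∀ k, |A j k| ≤ (m : ℤ)) ∧
    (fun k => (A j k : ℝ)) ∉ earlierRowSpan A j ∧
    (∀ w : Fin (n + 1) → ℤ, (∀ k, |w k| ≤ (m : ℤ)) →
      ((fun k => (w k : ℝ)) ∉ earlierRowSpan A j) → |xi α (A j)| ≤ |xi α w|) ∧
    (∃ k₀ : Fin (n + 1), 0 < A j k₀ ∧ ∀ k < k₀, A j k = 0)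

/-- `B` (indexed from 0, so `B 0 = B₁`) is the Minkowski chain of `α`: the subsequence of
distinct matrices among the matrices `A m` produced by the Minkowski algorithm, starting
with `A 1`. -/
def IsMinkowskiChain {n : ℕ} (α : Fin n → ℝ)
    (B : ℕ → Matrix (Fin (n + 1)) (Fin (n + 1)) ℤ) : Prop :=
  ∃ (A : ℕ → Matrix (Fin (n + 1)) (Fin (n + 1)) ℤ) (idx : ℕ → ℕ),
    (∀ m, 1 ≤ m → IsMinkowskiMatrix α m (A m)) ∧
    StrictMono idx ∧ idx 0 = 1 ∧
    (∀ k, B k = A (idx k)) ∧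
    (∀ k m, idx k ≤ m → m < idx (k + 1) → A m = A (idx k)) ∧
    (∀ k, A (idx (k + 1)) ≠ A (idx k))

/-- Denominators of the convergents of the continued fraction with partial quotients `a`,
shifted so that `convDen a 0 = 0` and `convDen a 1 = 1`. -/
def convDen (a : ℕ → ℤ) : ℕ → ℤ
  | 0 => 0
  | 1 => 1
  | j + 2 => a j * convDen a (j + 1) + convDen a j

/-- Numerators of the convergents of the continued fraction with partial quotients `a`,
shifted so that `convNum a 0 = 1` and `convNum a 1 = 0`. -/
def convNum (a : ℕ → ℤ) : ℕ → ℤ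
  | 0 => 1
  | 1 => 0
  | j + 2 => a j * convNum a (j + 1) + convNum a j

section Convergents

variable {a : ℕ → ℤ}

theorem convDen_nonneg_and_pos (ha : ∀ j, 1 ≤ a j) (j : ℕ) :
    0 ≤ convDen a j ∧ 1 ≤ convDen a (j + 1) := by
  induction j with
  | zero => simp [convDen]
  | succ j ih =>
    refine ⟨by linarith [ih.2], ?_⟩
    rw [convDen]
    nlinarith [ha j, ih.1, ih.2]

theorem mul_convDen_le (ha : ∀ j, 1 ≤ a j) (j : ℕ) :
    a j * convDen a (j + 1) ≤ convDen a (j + 2) := by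
  rw [convDen]
  linarith [(convDen_nonneg_and_pos ha j).1]

theorem convDen_le_succ (ha : ∀ j, 1 ≤ a j) (j : ℕ) : convDen a j ≤ convDen a (j + 1) := by
  cases j with
  | zero => simp [convDen]
  | succ j =>
    nlinarith [ha j, mul_convDen_le ha j, (convDen_nonneg_and_pos ha j).2]

theorem le_convDen (ha : ∀ j, 1 ≤ a j) (j : ℕ) : (j : ℤ) ≤ convDen a (j + 1) := by
  induction j with
  | zero => simp [convDen]
  | succ j ih =>
    rcases j with _ | j
    · simpa [convDen] using ha 0
    · rw [convDen]
      push_cast at ih ⊢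
      nlinarith [ha (j + 1), (convDen_nonneg_and_pos ha j).2,
        (convDen_nonneg_and_pos ha (j + 1)).2]

theorem convNum_nonneg (ha : ∀ j, 1 ≤ a j) (j : ℕ) :
    0 ≤ convNum a j ∧ 0 ≤ convNum a (j + 1) := by
  induction j with
  | zero => simp [convNum]
  | succ j ih =>
    refine ⟨ih.2, ?_⟩
    rw [convNum]
    nlinarith [ha j, ih.1, ih.2]

theorem convNum_le_convDen (ha : ∀ j, 1 ≤ a j) (j : ℕ) :
    convNum a (j + 1) ≤ convDen a (j + 1) ∧ convNum a (j + 2) ≤ convDen a (j + 2) := by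
  induction j with
  | zero => simpa [convNum, convDen] using ha 0
  | succ j ih =>
    refine ⟨ih.2, ?_⟩
    rw [convNum, convDen]
    nlinarith [ha (j + 1), ih.1, ih.2]

theorem convDen_mul_convNum_sub (a : ℕ → ℤ) (j : ℕ) :
    convDen a j * convNum a (j + 1) - convDen a (j + 1) * convNum a j = (-1) ^ (j + 1) := by
  induction j with
  | zero => simp [convDen, convNum]
  | succ j ih =>
    rw [convDen, convNum, pow_succ]
    linear_combination -ih

/-- There is a consecutive pair of convergent denominators around every `m ≥ 1`. -/
theorem exists_convDen_le_lt (ha : ∀ j, 1 ≤ a j) (m : ℕ) (hm : 1 ≤ m) :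
    ∃ j, convDen a (j + 1) ≤ m ∧ (m : ℤ) < convDen a (j + 2) := by
  have hex : ∃ j, (m : ℤ) < convDen a (j + 1) :=
    ⟨m + 1, by have := le_convDen ha (m + 1); push_cast at this; linarith⟩
  have hspec := Nat.find_spec hex
  obtain ⟨j, hj⟩ : ∃ j, Nat.find hex = j + 1 := by
    refine Nat.exists_eq_succ_of_ne_zero fun h => ?_
    rw [h] at hspec
    simp only [convDen] at hspec
    omega
  refine ⟨j, ?_, by rwa [hj] at hspec⟩
  exact not_lt.1 (Nat.find_min hex (by omega : j < Nat.find hex))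

end Convergents

section GaussMap

variable {a : ℕ → ℤ} {θ : ℕ → ℝ}

theorem convDen_mul_sub_convNum (hθ : ∀ j, 0 < θ j)
    (hrec : ∀ j, θ (j + 1) = (θ j)⁻¹ - (a j : ℝ)) (j : ℕ) :
    (convDen a j * θ 0 - convNum a j = (-1) ^ (j + 1) * ∏ i ∈ Finset.range j, θ i) ∧
    (convDen a (j + 1) * θ 0 - convNum a (j + 1) =
      (-1) ^ (j + 2) * ∏ i ∈ Finset.range (j + 1), θ i) := by
  induction j with
  | zero => simp [convDen, convNum]
  | succ j ih =>
    refine ⟨ih.2, ?_⟩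
    have h := ih.2
    have h' : θ (j + 1) * θ j = 1 - a j * θ j := by
      rw [hrec, sub_mul, inv_mul_cancel₀ (hθ j).ne']
    rw [convDen, convNum, Finset.prod_range_succ, Finset.prod_range_succ]
    rw [Finset.prod_range_succ] at h
    push_cast
    rw [pow_succ, pow_succ] at h ⊢
    rw [pow_succ]
    have h0 := ih.1
    rw [pow_succ] at h0
    linear_combination (a j : ℝ) * h + h0 -
      (-1 : ℝ) ^ j * (-1) * (∏ i ∈ Finset.range j, θ i) * h'

theorem convDen_succ_mul_prod_le_one (ha : ∀ j, 1 ≤ a j) (hθ : ∀ j, 0 < θ j)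
    (hrec : ∀ j, θ (j + 1) = (θ j)⁻¹ - (a j : ℝ)) (j : ℕ) :
    convDen a (j + 1) * ∏ i ∈ Finset.range j, θ i ≤ 1 := by
  obtain ⟨h1, h2⟩ := convDen_mul_sub_convNum hθ hrec j
  have hdet : (convDen a j * convNum a (j + 1) - convDen a (j + 1) * convNum a j : ℝ)
      = (-1) ^ (j + 1) := by exact_mod_cast convDen_mul_convNum_sub a j
  have hD : 0 < ∏ i ∈ Finset.range (j + 1), θ i := Finset.prod_pos fun i _ => hθ i
  have hQ : (0 : ℝ) ≤ convDen a j := by exact_mod_cast (convDen_nonneg_and_pos ha j).1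
  have hs : ((-1 : ℝ) ^ (j + 1)) * (-1) ^ (j + 1) = 1 := by
    rw [← mul_pow]; norm_num
  have key : convDen a (j + 1) * ∏ i ∈ Finset.range j, θ i +
      convDen a j * ∏ i ∈ Finset.range (j + 1), θ i = 1 := by
    rw [pow_succ _ (j + 1)] at h2
    generalize (-1 : ℝ) ^ (j + 1) = s at *
    generalize ∏ i ∈ Finset.range j, θ i = D at *
    generalize ∏ i ∈ Finset.range (j + 1), θ i = D' at *
    linear_combination s * hdet - s * (convDen a (j + 1) : ℝ) * h1 + s * (convDen a j : ℝ) * h2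
      + (1 - convDen a (j + 1) * D - convDen a j * D') * hs
  nlinarith [mul_nonneg hQ hD.le]

/-- If `|x * Q₁ + y * Q₂| < Q₂`, then `x` is nonzero and `x`, `y` do not have the same strict
sign, so there is no cancellation in `x * D₁ - y * D₂`. -/
theorem le_abs_mul_sub_mul {Q₁ Q₂ x y : ℤ} {D₁ D₂ : ℝ} (hQ₁ : 0 ≤ Q₁) (hD₁ : 0 ≤ D₁)
    (hD₂ : 0 ≤ D₂) (hq : |x * Q₁ + y * Q₂| < Q₂) (hxy : x ≠ 0 ∨ y ≠ 0) :
    D₁ ≤ |x * D₁ - y * D₂| := by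
  rw [abs_lt] at hq
  rw [le_abs]
  have hQ₂ : 0 < Q₂ := by linarith
  rcases lt_trichotomy x 0 with hx | hx | hx
  · right
    have hy : 0 ≤ y := by
      by_contra! hy
      nlinarith [mul_nonneg hQ₁ (by linarith : 0 ≤ -x)]
    have hx' : (x : ℝ) ≤ -1 := by exact_mod_cast (by omega : x ≤ -1)
    have hy' : (0 : ℝ) ≤ y := by exact_mod_cast hy
    nlinarith [mul_nonneg hy' hD₂]
  · exfalso
    subst hx
    have hy : y ≠ 0 := by simpa using hxy
    rcases lt_or_gt_of_ne hy with hy | hy <;> nlinarith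
  · left
    have hy : y ≤ 0 := by
      by_contra! hy
      nlinarith [mul_nonneg hQ₁ hx.le]
    have hx' : (1 : ℝ) ≤ x := by exact_mod_cast hx
    have hy' : (y : ℝ) ≤ 0 := by exact_mod_cast hy
    nlinarith [mul_nonneg (neg_nonneg.2 hy') hD₂]

/-- The best approximation property of convergents. -/
theorem prod_le_abs_of_abs_lt_convDen (ha : ∀ j, 1 ≤ a j) (hθ : ∀ j, 0 < θ j)
    (hrec : ∀ j, θ (j + 1) = (θ j)⁻¹ - (a j : ℝ)) (j : ℕ) {q p : ℤ}
    (hq : |q| < convDen a (j + 1)) (hqp : q ≠ 0 ∨ p ≠ 0) :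
    ∏ i ∈ Finset.range j, θ i ≤ |p + θ 0 * q| := by
  obtain ⟨h1, h2⟩ := convDen_mul_sub_convNum hθ hrec j
  have hdet := convDen_mul_convNum_sub a j
  have hs : ((-1 : ℤ) ^ (j + 1)) * (-1) ^ (j + 1) = 1 := by
    rw [← mul_pow]; norm_num
  rw [pow_succ _ (j + 1)] at h2
  have hcast : ((-1 : ℝ) ^ (j + 1)) = (((-1 : ℤ) ^ (j + 1) : ℤ) : ℝ) := by push_cast; rfl
  have habs : |(((-1 : ℤ) ^ (j + 1) : ℤ) : ℝ)| = 1 := by simp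
  rw [hcast] at h1 h2
  generalize (-1 : ℤ) ^ (j + 1) = s at *
  have hD : 0 < ∏ i ∈ Finset.range j, θ i := Finset.prod_pos fun i _ => hθ i
  have hD' : 0 < ∏ i ∈ Finset.range (j + 1), θ i := Finset.prod_pos fun i _ => hθ i
  generalize ∏ i ∈ Finset.range j, θ i = D at *
  generalize ∏ i ∈ Finset.range (j + 1), θ i = D' at *
  obtain ⟨x, hx⟩ : ∃ x, x = s * (q * convNum a (j + 1) + p * convDen a (j + 1)) := ⟨_, rfl⟩
  obtain ⟨y, hy⟩ : ∃ y, y = -s * (q * convNum a j + p * convDen a j) := ⟨_, rfl⟩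
  have hqeq : q = x * convDen a j + y * convDen a (j + 1) := by
    rw [hx, hy]; linear_combination -q * hs - s * q * hdet
  have hpeq : p = -(x * convNum a j + y * convNum a (j + 1)) := by
    rw [hx, hy]; linear_combination -p * hs - s * p * hdet
  have hxy : x ≠ 0 ∨ y ≠ 0 := by
    by_contra! h
    rw [h.1, h.2] at hqeq hpeq
    simp at hqeq hpeq
    exact hqp.elim (· hqeq) (· hpeq)
  have hform : (p : ℝ) + θ 0 * q = s * (x * D - y * D') := by
    rw [hqeq, hpeq]
    push_cast
    linear_combination (x : ℝ) * h1 + (y : ℝ) * h2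
  rw [hform, abs_mul, habs, one_mul]
  rw [hqeq] at hq
  exact le_abs_mul_sub_mul (convDen_nonneg_and_pos ha j).1 hD.le hD'.le hq hxy

theorem abs_convNum_add_convDen (hθ : ∀ j, 0 < θ j)
    (hrec : ∀ j, θ (j + 1) = (θ j)⁻¹ - (a j : ℝ)) (j : ℕ) :
    |((-convNum a j : ℤ) : ℝ) + θ 0 * convDen a j| = ∏ i ∈ Finset.range j, θ i := by
  have h := (convDen_mul_sub_convNum hθ hrec j).1
  rw [show ((-convNum a j : ℤ) : ℝ) + θ 0 * convDen a j = convDen a j * θ 0 - convNum a j by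
    push_cast; ring, h, abs_mul, abs_pow, abs_neg, abs_one, one_pow, one_mul,
    abs_of_pos (Finset.prod_pos fun i _ => hθ i)]

end GaussMap

section MinkowskiMatrix

theorem xi_fin_one (α : ℝ) (w : Fin 2 → ℤ) :
    xi (fun _ : Fin 1 => α) w = w 1 + α * w 0 := by
  simp [xi, Fin.last]

theorem notMem_earlierRowSpan_zero {A : Matrix (Fin 2) (Fin 2) ℤ} {w : Fin 2 → ℤ} :
    (fun k => (w k : ℝ)) ∉ earlierRowSpan A 0 ↔ w 0 ≠ 0 ∨ w 1 ≠ 0 := by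
  simp [earlierRowSpan, funext_iff, Fin.forall_fin_two, imp_iff_not_or]

theorem notMem_earlierRowSpan_one {A : Matrix (Fin 2) (Fin 2) ℤ} {w : Fin 2 → ℤ}
    (hA : A 0 0 ≠ 0 ∨ A 0 1 ≠ 0) :
    (fun k => (w k : ℝ)) ∉ earlierRowSpan A 1 ↔ A 0 0 * w 1 - A 0 1 * w 0 ≠ 0 := by
  have hset : {x : Fin 2 → ℝ | ∃ i : Fin 2, i < 1 ∧ x = fun k => (A i k : ℝ)} =
      {fun k => (A 0 k : ℝ)} := by
    ext x
    simp
  rw [earlierRowSpan, hset, Submodule.mem_span_singleton, not_iff_not]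
  constructor
  · rintro ⟨c, hc⟩
    have e0 := congrFun hc 0
    have e1 := congrFun hc 1
    simp only [Pi.smul_apply, smul_eq_mul] at e0 e1
    have : (A 0 0 * w 1 - A 0 1 * w 0 : ℝ) = 0 := by rw [← e0, ← e1]; ring
    exact_mod_cast this
  · intro h
    have h' : (A 0 0 * w 1 - A 0 1 * w 0 : ℝ) = 0 := by exact_mod_cast h
    rcases hA with hA | hA
    · have hA' : (A 0 0 : ℝ) ≠ 0 := by exact_mod_cast hA
      refine ⟨w 0 / A 0 0, funext fun k => ?_⟩
      fin_cases k <;> simp only [Pi.smul_apply, smul_eq_mul] <;> field_simp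
      · exact mul_comm _ _
      · simp; linarith
    · have hA' : (A 0 1 : ℝ) ≠ 0 := by exact_mod_cast hA
      refine ⟨w 1 / A 0 1, funext fun k => ?_⟩
      fin_cases k <;> simp only [Pi.smul_apply, smul_eq_mul] <;> field_simp
      · simp; linarith
      · exact mul_comm _ _

variable {α : ℝ} {m : ℕ} {A : Matrix (Fin 2) (Fin 2) ℤ}

theorem IsMinkowskiMatrix.abs_xi_zero_le (hA : IsMinkowskiMatrix (fun _ : Fin 1 => α) m A)
    {q p : ℤ} (hq : |q| ≤ m) (hp : |p| ≤ m) (hqp : q ≠ 0 ∨ p ≠ 0) :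
    |xi (fun _ : Fin 1 => α) (A 0)| ≤ |p + α * q| := by
  have h := (hA 0).2.2.1 ![q, p] (by simp [Fin.forall_fin_two, hq, hp])
    (notMem_earlierRowSpan_zero.2 (by simpa using hqp))
  simpa [xi_fin_one] using h

theorem IsMinkowskiMatrix.row_zero_ne (hA : IsMinkowskiMatrix (fun _ : Fin 1 => α) m A) :
    A 0 0 ≠ 0 ∨ A 0 1 ≠ 0 :=
  notMem_earlierRowSpan_zero.1 (hA 0).2.1

theorem IsMinkowskiMatrix.abs_xi_one_le (hA : IsMinkowskiMatrix (fun _ : Fin 1 => α) m A)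
    {q p : ℤ} (hq : |q| ≤ m) (hp : |p| ≤ m) (hqp : A 0 0 * p - A 0 1 * q ≠ 0) :
    |xi (fun _ : Fin 1 => α) (A 1)| ≤ |p + α * q| := by
  have h := (hA 1).2.2.1 ![q, p] (by simp [Fin.forall_fin_two, hq, hp])
    ((notMem_earlierRowSpan_one hA.row_zero_ne).2 (by simpa using hqp))
  simpa [xi_fin_one] using h

theorem IsMinkowskiMatrix.det_ne_zero (hA : IsMinkowskiMatrix (fun _ : Fin 1 => α) m A) :
    A 0 0 * A 1 1 - A 0 1 * A 1 0 ≠ 0 :=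
  (notMem_earlierRowSpan_one hA.row_zero_ne).1 (hA 1).2.1

theorem IsMinkowskiMatrix.abs_xi_zero_le_abs_xi_one
    (hA : IsMinkowskiMatrix (fun _ : Fin 1 => α) m A) :
    |xi (fun _ : Fin 1 => α) (A 0)| ≤ |xi (fun _ : Fin 1 => α) (A 1)| := by
  refine (hA 0).2.2.1 (A 1) (hA 1).1 (notMem_earlierRowSpan_zero.2 ?_)
  by_contra! h
  exact hA.det_ne_zero (by simp [h.1, h.2])

theorem IsMinkowskiMatrix.one_le_two_mul_abs_xi_one
    (hA : IsMinkowskiMatrix (fun _ : Fin 1 => α) m A) :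
    1 ≤ 2 * m * |xi (fun _ : Fin 1 => α) (A 1)| := by
  have hdet : (1 : ℝ) ≤ |(A 0 0 * A 1 1 - A 0 1 * A 1 0 : ℝ)| := by
    exact_mod_cast Int.one_le_abs hA.det_ne_zero
  have hq0 : |(A 0 0 : ℝ)| ≤ m := by exact_mod_cast (hA 0).1 0
  have hq1 : |(A 1 0 : ℝ)| ≤ m := by exact_mod_cast (hA 1).1 0
  have hle := hA.abs_xi_zero_le_abs_xi_one
  have heq : (A 0 0 * A 1 1 - A 0 1 * A 1 0 : ℝ) = A 0 0 * xi (fun _ : Fin 1 => α) (A 1) -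
      A 1 0 * xi (fun _ : Fin 1 => α) (A 0) := by
    simp only [xi_fin_one]; ring
  rw [heq] at hdet
  have htri := abs_sub (A 0 0 * xi (fun _ : Fin 1 => α) (A 1))
    (A 1 0 * xi (fun _ : Fin 1 => α) (A 0))
  rw [abs_mul, abs_mul] at htri
  have b1 := mul_le_mul_of_nonneg_right hq0 (abs_nonneg (xi (fun _ : Fin 1 => α) (A 1)))
  have b2 := mul_le_mul hq1 hle (abs_nonneg _) (Nat.cast_nonneg m)
  linarith

end MinkowskiMatrix

/-- A bound on all partial quotients bounds the ratio of the two forms from below. -/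
theorem IsMinkowskiMatrix.le_abs_div {a : ℕ → ℤ} {θ : ℕ → ℝ} {m : ℕ} (hm : 1 ≤ m)
    {A : Matrix (Fin 2) (Fin 2) ℤ} (ha : ∀ j, 1 ≤ a j) (hθ : ∀ j, 0 < θ j ∧ θ j < 1)
    (hrec : ∀ j, θ (j + 1) = (θ j)⁻¹ - (a j : ℝ)) {M : ℤ} (hM : ∀ j, a j ≤ M)
    (hA : IsMinkowskiMatrix (fun _ : Fin 1 => θ 0) m A) :
    1 / ((M : ℝ) + 1) ≤
      |xi (fun _ : Fin 1 => θ 0) (A 0) / xi (fun _ : Fin 1 => θ 0) (A 1)| := by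
  have hpos j := (hθ j).1
  obtain ⟨j, hj, hj'⟩ := exists_convDen_le_lt ha m hm
  have hlow : ∏ i ∈ Finset.range (j + 1), θ i ≤ |xi (fun _ : Fin 1 => θ 0) (A 0)| := by
    rw [xi_fin_one]
    exact prod_le_abs_of_abs_lt_convDen ha hpos hrec (j + 1)
      (lt_of_le_of_lt ((hA 0).1 0) hj') hA.row_zero_ne
  have hD : 0 < ∏ i ∈ Finset.range j, θ i := Finset.prod_pos fun i _ => hpos i
  have habs (i : ℕ) := abs_convNum_add_convDen hpos hrec i
  have hq0 : |convDen a j| ≤ m := by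
    rw [abs_of_nonneg (convDen_nonneg_and_pos ha j).1]
    exact (convDen_le_succ ha j).trans hj
  have hq1 : |convDen a (j + 1)| ≤ m := by
    rwa [abs_of_nonneg (convDen_nonneg_and_pos ha (j + 1)).1]
  have hp1 : |-convNum a (j + 1)| ≤ m := by
    rw [abs_neg, abs_of_nonneg (convNum_nonneg ha (j + 1)).1]
    exact (convNum_le_convDen ha j).1.trans hj
  have hp0 : |-convNum a j| ≤ m := by
    rw [abs_neg, abs_of_nonneg (convNum_nonneg ha j).1]
    cases j with
    | zero => simpa [convNum] using hm
    | succ j => exact (convNum_le_convDen ha j).1.trans ((convDen_le_succ ha _).trans hj)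
  have hup : |xi (fun _ : Fin 1 => θ 0) (A 1)| ≤ ∏ i ∈ Finset.range j, θ i := by
    by_cases h0 : A 0 0 * (-convNum a j) - A 0 1 * convDen a j = 0
    · by_cases h1 : A 0 0 * (-convNum a (j + 1)) - A 0 1 * convDen a (j + 1) = 0
      · exfalso
        have hdet := convDen_mul_convNum_sub a j
        have hne : ((-1 : ℤ) ^ (j + 1)) ≠ 0 := by simp
        rw [← hdet] at hne
        rcases hA.row_zero_ne with h | h
        · exact mul_ne_zero h hne (by
            linear_combination convDen a (j + 1) * h0 - convDen a j * h1)
        · exact mul_ne_zero h hne (by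
            linear_combination convNum a j * h1 - convNum a (j + 1) * h0)
      · refine (hA.abs_xi_one_le hq1 hp1 h1).trans ?_
        rw [habs, Finset.prod_range_succ]
        exact mul_le_of_le_one_right hD.le (hθ j).2.le
    · exact (hA.abs_xi_one_le hq0 hp0 h0).trans_eq (habs j)
  have hD' : 0 < ∏ i ∈ Finset.range (j + 1), θ i := Finset.prod_pos fun i _ => hpos i
  have hx1 : 0 < |xi (fun _ : Fin 1 => θ 0) (A 1)| :=
    hD'.trans_le (hlow.trans hA.abs_xi_zero_le_abs_xi_one)
  have hM1 : (0 : ℝ) < M + 1 := by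
    exact_mod_cast (by linarith [ha 0, hM 0] : 0 < M + 1)
  have hθj : 1 ≤ θ j * (M + 1) := by
    have hlt := (hθ (j + 1)).2
    rw [hrec] at hlt
    have haM : (a j : ℝ) ≤ M := by exact_mod_cast hM j
    have hmul := mul_inv_cancel₀ (hpos j).ne'
    nlinarith [hpos j]
  rw [abs_div, div_le_div_iff₀ hM1 hx1, one_mul]
  calc |xi (fun _ : Fin 1 => θ 0) (A 1)|
      ≤ (∏ i ∈ Finset.range j, θ i) * (θ j * (M + 1)) :=
        hup.trans (le_mul_of_one_le_right hD.le hθj)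
    _ = (∏ i ∈ Finset.range (j + 1), θ i) * (M + 1) := by rw [Finset.prod_range_succ]; ring
    _ ≤ _ := mul_le_mul_of_nonneg_right hlow hM1.le

/-- At `m` a convergent denominator, the next partial quotient bounds the ratio of the two
forms from above. -/
theorem IsMinkowskiMatrix.mul_abs_div_le_two {a : ℕ → ℤ} {θ : ℕ → ℝ} {m j : ℕ}
    {A : Matrix (Fin 2) (Fin 2) ℤ} (ha : ∀ j, 1 ≤ a j) (hθ : ∀ j, 0 < θ j)
    (hrec : ∀ j, θ (j + 1) = (θ j)⁻¹ - (a j : ℝ)) (hm : (m : ℤ) = convDen a (j + 1))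
    (hA : IsMinkowskiMatrix (fun _ : Fin 1 => θ 0) m A) :
    a j * |xi (fun _ : Fin 1 => θ 0) (A 0) / xi (fun _ : Fin 1 => θ 0) (A 1)| ≤ 2 := by
  have hQ := (convDen_nonneg_and_pos ha j).2
  have h0 : |xi (fun _ : Fin 1 => θ 0) (A 0)| ≤ ∏ i ∈ Finset.range (j + 1), θ i := by
    rw [← abs_convNum_add_convDen hθ hrec]
    refine hA.abs_xi_zero_le ?_ ?_ (Or.inl (by omega))
    · rw [hm, abs_of_nonneg (by omega)]
    · rw [hm, abs_neg, abs_of_nonneg (convNum_nonneg ha (j + 1)).1]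
      exact (convNum_le_convDen ha j).1
  have h1 := hA.one_le_two_mul_abs_xi_one
  have hmR : (m : ℝ) = convDen a (j + 1) := by exact_mod_cast hm
  have hle : (a j : ℝ) * m ≤ convDen a (j + 2) := by
    rw [hmR]; exact_mod_cast mul_convDen_le ha j
  have hprod := convDen_succ_mul_prod_le_one ha hθ hrec (j + 1)
  have hD : 0 < ∏ i ∈ Finset.range (j + 1), θ i := Finset.prod_pos fun i _ => hθ i
  have haj : (0 : ℝ) ≤ a j := by exact_mod_cast (by linarith [ha j] : 0 ≤ a j)
  have hx1 : 0 < |xi (fun _ : Fin 1 => θ 0) (A 1)| := by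
    refine (abs_nonneg _).lt_of_ne fun h => ?_
    rw [← h] at h1
    norm_num at h1
  rw [abs_div, ← mul_div_assoc, div_le_iff₀ hx1]
  have e1 : (a j : ℝ) * m * ∏ i ∈ Finset.range (j + 1), θ i ≤ 1 :=
    (mul_le_mul_of_nonneg_right hle hD.le).trans hprod
  calc (a j : ℝ) * |xi (fun _ : Fin 1 => θ 0) (A 0)|
      ≤ a j * (∏ i ∈ Finset.range (j + 1), θ i) *
          (2 * m * |xi (fun _ : Fin 1 => θ 0) (A 1)|) :=
        (mul_le_mul_of_nonneg_left h0 haj).trans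
          (le_mul_of_one_le_right (mul_nonneg haj hD.le) h1)
    _ = a j * m * (∏ i ∈ Finset.range (j + 1), θ i) *
          (2 * |xi (fun _ : Fin 1 => θ 0) (A 1)|) := by ring
    _ ≤ 2 * |xi (fun _ : Fin 1 => θ 0) (A 1)| :=
        mul_le_of_le_one_left (by positivity) e1

/-- Every matrix produced by the Minkowski algorithm occurs in the chain. -/
theorem IsMinkowskiChain.exists_isMinkowskiMatrix {n : ℕ} {α : Fin n → ℝ}
    {B : ℕ → Matrix (Fin (n + 1)) (Fin (n + 1)) ℤ} (hB : IsMinkowskiChain α B) {m : ℕ}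
    (hm : 1 ≤ m) : ∃ k, IsMinkowskiMatrix α m (B k) := by
  obtain ⟨A, idx, hA, hidx, hidx0, hBA, hconst, -⟩ := hB
  have hex : ∃ k, m < idx k := ⟨m + 1, hidx.le_apply⟩
  have hspec := Nat.find_spec hex
  obtain ⟨k, hk⟩ : ∃ k, Nat.find hex = k + 1 := by
    refine Nat.exists_eq_succ_of_ne_zero fun h => ?_
    rw [h] at hspec
    omega
  rw [hk] at hspec
  have hle : idx k ≤ m := not_lt.1 (Nat.find_min hex (by omega : k < Nat.find hex))
  exact ⟨k, by rw [hBA, ← hconst k m hle hspec]; exact hA m hm⟩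

theorem IsMinkowskiChain.isMinkowskiMatrix {n : ℕ} {α : Fin n → ℝ}
    {B : ℕ → Matrix (Fin (n + 1)) (Fin (n + 1)) ℤ} (hB : IsMinkowskiChain α B) (k : ℕ) :
    ∃ m, 1 ≤ m ∧ IsMinkowskiMatrix α m (B k) := by
  obtain ⟨A, idx, hA, hidx, hidx0, hBA, -, -⟩ := hB
  have h : 1 ≤ idx k := hidx0 ▸ hidx.monotone (Nat.zero_le k)
  exact ⟨idx k, h, by rw [hBA]; exact hA _ h⟩

/-- Let `α ∈ (0,1)` be irrational, with regular continued fraction expansion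
`α = 1/(a₁ + 1/(a₂ + ⋯))`; here `a (j) = a_{j+1}` is encoded via the Gauss map:
`θ 0 = α`, `a j = ⌊1/θ j⌋` and `θ (j+1) = 1/θ j − a j`.  Let `α_{k,1}` be given by the
Minkowski chain of `α` (the case `n = 1`).  Then the partial quotients `a j` are bounded
if and only if `|α_{k,1}|` is bounded away from zero. -/
theorem bounded_partial_quotients_iff_bounded_away
    (α : ℝ) (hirr : Irrational α) (h0 : 0 < α) (h1 : α < 1)
    (a : ℕ → ℤ) (θ : ℕ → ℝ) (hθ0 : θ 0 = α)
    (hθ : ∀ j, 0 < θ j ∧ θ j < 1)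
    (ha : ∀ j, a j = ⌊(θ j)⁻¹⌋ ∧ θ (j + 1) = (θ j)⁻¹ - (a j : ℝ))
    (B : ℕ → Matrix (Fin 2) (Fin 2) ℤ)
    (hB : IsMinkowskiChain (fun _ : Fin 1 => α) B) :
    (∃ M : ℤ, ∀ j, a j ≤ M) ↔
      ∃ c > (0 : ℝ), ∀ k : ℕ,
        c ≤ |xi (fun _ : Fin 1 => α) (B k 0) / xi (fun _ : Fin 1 => α) (B k 1)| := by
  have ha1 : ∀ j, 1 ≤ a j := fun j => by
    rw [(ha j).1, Int.le_floor]
    exact_mod_cast (one_le_inv₀ (hθ j).1).2 (hθ j).2.le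
  have hrec j := (ha j).2
  have hpos j := (hθ j).1
  subst hθ0
  constructor
  · rintro ⟨M, hM⟩
    have hM1 : (0 : ℝ) < M + 1 := by
      exact_mod_cast (by linarith [ha1 0, hM 0] : 0 < M + 1)
    refine ⟨1 / (M + 1), by positivity, fun k => ?_⟩
    obtain ⟨m, hm, hk⟩ := hB.isMinkowskiMatrix k
    exact hk.le_abs_div hm ha1 hθ hrec hM
  · rintro ⟨c, hc, hck⟩
    refine ⟨⌈2 / c⌉, fun j => ?_⟩
    have hQ := (convDen_nonneg_and_pos ha1 j).2
    obtain ⟨m, hm⟩ := Int.eq_ofNat_of_zero_le (by omega : 0 ≤ convDen a (j + 1))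
    obtain ⟨k, hk⟩ := hB.exists_isMinkowskiMatrix (by omega : 1 ≤ m)
    have h2 := hk.mul_abs_div_le_two ha1 hpos hrec hm.symm
    have haj : (0 : ℝ) ≤ a j := by exact_mod_cast (by linarith [ha1 j] : 0 ≤ a j)
    have : (a j : ℝ) ≤ 2 / c := by
      rw [le_div_iff₀ hc]
      exact (mul_le_mul_of_nonneg_left (hck k) haj).trans h2
    exact_mod_cast this.trans (Int.le_ceil _)
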